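/- Let n ≥ 2, 1 < q < ∞, and suppose (θ1,θ2) ∈ [(A ∪ B) ∩ (C_q ∪ D_q)] ∪ {(θ1,θ2) : θ1 = 0, θ2 > −n}. Then there exists a constant C = C(n,q,θ1,θ2) > 0 such that for every R > 0, every pair of real numbers l > k, and every continuously differentiable function u : ℝ^n → ℝ, one has (l−k)^q · μ({x ∈ B_R(0) : u(x) ≤ k})^q · μ({x ∈ B_R(0) : u(x) ≥ l}) ≤ C R^{q(n+θ1+θ2+1)} ∫_{{x ∈ B_R(0) : k < u(x) < l}} |∇u|^q dμ, where dμ = |x'|^{θ1}|x|^{θ2} dx (weighted isoperimetric inequality of De Giorgi type, second form). -/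

import Mathlib

open MeasureTheory Metric Set
open scoped ENNReal NNReal Topology

noncomputable section

/-- `ℝ^n` as a Euclidean space. -/
abbrev En (n : ℕ) := EuclideanSpace ℝ (Fin n)

/-- `|x'|`: the Euclidean norm of the first `n-1` coordinates of `x`. -/
def normPrime (n : ℕ) (x : En n) : ℝ :=
  Real.sqrt (∑ i : Fin n, if (i : ℕ) + 1 < n then (x i) ^ 2 else 0)

/-- The anisotropic weight `w(x) = |x'|^θ1 * |x|^θ2`. -/
def weight (n : ℕ) (θ1 θ2 : ℝ) (x : En n) : ℝ :=
  normPrime n x ^ θ1 * ‖x‖ ^ θ2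

/-- The measure `dμ = w dx` on `ℝ^n`. -/
def muW (n : ℕ) (θ1 θ2 : ℝ) : Measure (En n) :=
  (volume : Measure (En n)).withDensity fun x => ENNReal.ofReal (weight n θ1 θ2 x)

/-- The index set `𝒜 = {(a,b) : a > -(n-1), b ≥ 0}`. -/
def setA (n : ℕ) : Set (ℝ × ℝ) := {p | -((n : ℝ) - 1) < p.1 ∧ 0 ≤ p.2}

/-- The index set `ℬ = {(a,b) : a > -(n-1), b < 0, a + b > -n}`. -/
def setB (n : ℕ) : Set (ℝ × ℝ) :=
  {p | -((n : ℝ) - 1) < p.1 ∧ p.2 < 0 ∧ -(n : ℝ) < p.1 + p.2}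

/-- The index set `𝒞_q = {(a,b) : a < (n-1)(q-1), b ≤ 0}`. -/
def setC (n : ℕ) (q : ℝ) : Set (ℝ × ℝ) := {p | p.1 < ((n : ℝ) - 1) * (q - 1) ∧ p.2 ≤ 0}

/-- The index set `𝒟_q = {(a,b) : a < (n-1)(q-1), b > 0, a+b < n(q-1)}`. -/
def setD (n : ℕ) (q : ℝ) : Set (ℝ × ℝ) :=
  {p | p.1 < ((n : ℝ) - 1) * (q - 1) ∧ 0 < p.2 ∧ p.1 + p.2 < (n : ℝ) * (q - 1)}

/-- The index set `ℱ = {(a,b) : a + b > -(n-1)}`. -/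
def setF (n : ℕ) : Set (ℝ × ℝ) := {p | -((n : ℝ) - 1) < p.1 + p.2}

theorem rpow_sub_one_mul_self {q : ℝ} (hq : 1 < q) (M : ℝ≥0∞) : M ^ (q - 1) * M = M ^ q := by
  conv_lhs => rw [← ENNReal.rpow_one M, ← ENNReal.rpow_mul, one_mul,
    ← ENNReal.rpow_add_of_nonneg _ _ (by linarith) zero_le_one, sub_add_cancel]

/-- Affine contraction towards `y`, as a change of variables. -/
theorem lintegral_comp_segment {n : ℕ} (F : En n → ℝ≥0∞) (y : En n) {t : ℝ} (ht : 0 < t) :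
    ∫⁻ x, F (y + t • (x - y)) = ENNReal.ofReal (t ^ n)⁻¹ * ∫⁻ z, F z := by
  have h1 : ∫⁻ x, F (y + t • (x - y)) = ∫⁻ x, F (y + t • x) :=
    lintegral_sub_right_eq_self (μ := (volume : Measure (En n))) (fun x => F (y + t • x)) y
  have h2 : ∫⁻ x : En n, F (y + t • x) = ∫⁻ x, F (y + x) ∂(Measure.map (t • ·) volume) :=
    ((Homeomorph.smulOfNeZero (α := En n) t ht.ne').measurableEmbedding.lintegral_map
      (μ := volume) (fun x => F (y + x))).symm
  have h3 : ∫⁻ x, F (y + x) = ∫⁻ z, F z :=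
    lintegral_add_left_eq_self (μ := (volume : Measure (En n))) F y
  rw [h1, h2, Measure.map_addHaar_smul _ ht.ne', lintegral_smul_measure, h3]
  simp [abs_of_pos ht]

theorem lintegral_comp_segment' {n : ℕ} (F : En n → ℝ≥0∞) (x : En n) {t : ℝ} (ht : t < 1) :
    ∫⁻ y, F (y + t • (x - y)) = ENNReal.ofReal ((1 - t) ^ n)⁻¹ * ∫⁻ z, F z := by
  rw [← lintegral_comp_segment F x (sub_pos.2 ht)]
  refine lintegral_congr fun y => congrArg F ?_
  module

/-- A `C¹` function dropping from `l` to `m` has gradient integral at least `l - m` over the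
transition region. -/
theorem ofReal_sub_le_lintegral_abs_deriv {h h' : ℝ → ℝ} (hd : ∀ t, HasDerivAt h (h' t) t)
    {m l : ℝ} (h0 : l ≤ h 0) (h1 : h 1 ≤ m) :
    ENNReal.ofReal (l - m) ≤
      ∫⁻ t in {t ∈ Ioo (0 : ℝ) 1 | m < h t ∧ h t < l}, ENNReal.ofReal |h' t| := by
  have hc : Continuous h := continuous_iff_continuousAt.2 fun t => (hd t).continuousAt
  have hS : MeasurableSet {t ∈ Ioo (0 : ℝ) 1 | m < h t ∧ h t < l} :=
    measurableSet_Ioo.inter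
      ((isOpen_lt continuous_const hc).inter (isOpen_lt hc continuous_const)).measurableSet
  have key := addHaar_image_le_lintegral_abs_det_fderiv volume hS
    (f := h) (f' := fun t => ContinuousLinearMap.toSpanSingleton ℝ (h' t))
    (fun t _ => (hd t).hasFDerivAt.hasFDerivWithinAt)
  simp only [ContinuousLinearMap.det_toSpanSingleton] at key
  refine le_trans ?_ key
  rw [← Real.volume_Ioo]
  refine measure_mono fun s hs => ?_
  obtain ⟨t, ht, rfl⟩ := intermediate_value_Ioo' zero_le_one hc.continuousOn
    (show s ∈ Ioo (h 1) (h 0) from ⟨h1.trans_lt hs.1, hs.2.trans_le h0⟩)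
  exact ⟨t, ⟨ht, hs⟩, rfl⟩

theorem lintegral_rpow_le_measure_rpow_mul {α : Type*} [MeasurableSpace α] (μ : Measure α)
    {q : ℝ} (hq : 1 < q) {f : α → ℝ≥0∞} (hf : AEMeasurable f μ) :
    (∫⁻ x, f x ∂μ) ^ q ≤ μ univ ^ (q - 1) * ∫⁻ x, f x ^ q ∂μ := by
  have hpq := Real.HolderConjugate.conjExponent hq
  have h := ENNReal.lintegral_mul_le_Lp_mul_Lq μ hpq hf (aemeasurable_const (b := (1 : ℝ≥0∞)))
  simp only [Pi.mul_apply, mul_one, ENNReal.one_rpow, lintegral_const, one_mul] at h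
  refine (ENNReal.rpow_le_rpow h (by linarith)).trans_eq ?_
  rw [ENNReal.mul_rpow_of_nonneg _ _ (by linarith), ← ENNReal.rpow_mul, ← ENNReal.rpow_mul,
    mul_comm]
  have : q ≠ 0 := by linarith
  have : q - 1 ≠ 0 := by linarith
  congr 2
  · rw [Real.conjExponent]; field_simp
  · rw [one_div_mul_cancel ‹q ≠ 0›, ENNReal.rpow_one]

/-- Weighted boundedness of averages over balls for a weight `ψ φ ^ (1 - q)` built from two
weights satisfying the `A₁` condition at radius `r`. -/
theorem lintegral_ball_average_rpow_le {n : ℕ} {q : ℝ} (hq : 1 < q) {φ ψ G : En n → ℝ≥0∞}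
    (hφm : Measurable φ) (hψm : Measurable ψ) (hG : Measurable G) {r : ℝ} {M : ℝ≥0∞}
    (hφ0 : ∀ᵐ y, φ y ≠ 0) (hφt : ∀ᵐ y, φ y ≠ ∞)
    (hφ : ∀ᵐ y, ∫⁻ z in ball y r, φ z ≤ M * φ y)
    (hψ : ∀ᵐ y, ∫⁻ z in ball y r, ψ z ≤ M * ψ y) :
    ∫⁻ y, (ψ y * φ y ^ (1 - q)) * (∫⁻ z in ball y r, G z) ^ q ≤
      M ^ q * ∫⁻ z, (ψ z * φ z ^ (1 - q)) * G z ^ q := by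
  set H : En n → ℝ≥0∞ := fun z => G z ^ q * φ z ^ (1 - q)
  have hH : Measurable H := by fun_prop
  have hq0 : q ≠ 0 := by linarith
  have hq1 : q - 1 ≠ 0 := by linarith
  have hpq := Real.HolderConjugate.conjExponent hq
  have hce : Real.conjExponent q = q / (q - 1) := rfl
  have hold : ∀ y, (∫⁻ z in ball y r, G z) ^ q ≤
      (∫⁻ z in ball y r, H z) * (∫⁻ z in ball y r, φ z) ^ (q - 1) := by
    intro y
    have h := ENNReal.lintegral_mul_le_Lp_mul_Lq (volume.restrict (ball y r)) hpq
      (f := fun z => G z * φ z ^ ((1 - q) / q)) (g := fun z => φ z ^ ((q - 1) / q))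
      (by fun_prop) (by fun_prop)
    have e1 : ∫⁻ z in ball y r, G z = ∫⁻ z in ball y r,
        ((fun z => G z * φ z ^ ((1 - q) / q)) * fun z => φ z ^ ((q - 1) / q)) z := by
      refine lintegral_congr_ae (ae_restrict_of_ae ?_)
      filter_upwards [hφ0, hφt] with z h0 ht
      simp only [Pi.mul_apply]
      rw [mul_assoc, ← ENNReal.rpow_add _ _ h0 ht, ← add_div, sub_add_sub_cancel, sub_self,
        zero_div, ENNReal.rpow_zero, mul_one]
    have e2 : ∀ z, (G z * φ z ^ ((1 - q) / q)) ^ q = H z := fun z => by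
      rw [ENNReal.mul_rpow_of_nonneg _ _ (by linarith), ← ENNReal.rpow_mul,
        div_mul_cancel₀ _ hq0]
    have e3 : ∀ z, (φ z ^ ((q - 1) / q)) ^ (q / (q - 1)) = φ z := fun z => by
      rw [← ENNReal.rpow_mul, div_mul_div_cancel₀ hq0, div_self hq1, ENNReal.rpow_one]
    rw [← e1, hce] at h
    simp only [e2, e3] at h
    refine (ENNReal.rpow_le_rpow h (by linarith)).trans_eq ?_
    rw [ENNReal.mul_rpow_of_nonneg _ _ (by linarith), ← ENNReal.rpow_mul, ← ENNReal.rpow_mul,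
      one_div_mul_cancel hq0, ENNReal.rpow_one]
    congr 2
    field_simp
  have step : ∫⁻ y, (ψ y * φ y ^ (1 - q)) * (∫⁻ z in ball y r, G z) ^ q ≤
      ∫⁻ y, M ^ (q - 1) * (ψ y * ∫⁻ z in ball y r, H z) := by
    refine lintegral_mono_ae ?_
    filter_upwards [hφ0, hφt, hφ] with y h0 ht hy
    calc (ψ y * φ y ^ (1 - q)) * (∫⁻ z in ball y r, G z) ^ q
        ≤ (ψ y * φ y ^ (1 - q)) * ((∫⁻ z in ball y r, H z) * (M * φ y) ^ (q - 1)) := by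
          gcongr
          exact (hold y).trans (by gcongr)
      _ = M ^ (q - 1) * (ψ y * ∫⁻ z in ball y r, H z) * (φ y ^ (1 - q) * φ y ^ (q - 1)) := by
          rw [ENNReal.mul_rpow_of_nonneg _ _ (by linarith)]; ring
      _ = M ^ (q - 1) * (ψ y * ∫⁻ z in ball y r, H z) := by
          rw [← ENNReal.rpow_add _ _ h0 ht, sub_add_sub_cancel, sub_self, ENNReal.rpow_zero,
            mul_one]
  have hset : MeasurableSet {p : En n × En n | dist p.2 p.1 < r} :=
    (isOpen_lt (by fun_prop) continuous_const).measurableSet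
  have hindm : Measurable fun p : En n × En n =>
      {p : En n × En n | dist p.2 p.1 < r}.indicator 1 p * (ψ p.1 * H p.2) :=
    ((measurable_one : Measurable (1 : En n × En n → ℝ≥0∞)).indicator hset).mul (by fun_prop)
  have swap : ∫⁻ y, ψ y * ∫⁻ z in ball y r, H z = ∫⁻ z, H z * ∫⁻ y in ball z r, ψ y := by
    have l : ∀ y, ψ y * ∫⁻ z in ball y r, H z = ∫⁻ z,
        {p : En n × En n | dist p.2 p.1 < r}.indicator 1 (y, z) * (ψ y * H z) := by
      intro y
      rw [← lintegral_const_mul _ hH, ← lintegral_indicator measurableSet_ball]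
      refine lintegral_congr fun z => ?_
      by_cases hz : dist z y < r <;> simp [indicator, mem_ball, hz]
    have l' : ∀ z, H z * ∫⁻ y in ball z r, ψ y = ∫⁻ y,
        {p : En n × En n | dist p.2 p.1 < r}.indicator 1 (y, z) * (ψ y * H z) := by
      intro z
      rw [← lintegral_const_mul _ hψm, ← lintegral_indicator measurableSet_ball]
      refine lintegral_congr fun y => ?_
      by_cases hz : dist z y < r <;> simp [indicator, mem_ball, dist_comm y z, hz, mul_comm]
    simp only [l, l']
    exact lintegral_lintegral_swap hindm.aemeasurable
  refine step.trans ?_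
  have hm : Measurable fun y => ψ y * ∫⁻ z in ball y r, H z := by
    refine hψm.mul ?_
    have : (fun y => ∫⁻ z in ball y r, H z) = fun y => ∫⁻ z,
        {p : En n × En n | dist p.2 p.1 < r}.indicator (fun p => H p.2) (y, z) := by
      ext y
      rw [← lintegral_indicator measurableSet_ball]
      refine lintegral_congr fun z => ?_
      by_cases hz : dist z y < r <;> simp [indicator, mem_ball, hz]
    rw [this]
    exact ((hH.comp measurable_snd).indicator hset).lintegral_prod_right'
  rw [lintegral_const_mul _ hm, swap]
  rw [← rpow_sub_one_mul_self hq M, mul_assoc]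
  gcongr
  rw [← lintegral_const_mul _ (by fun_prop)]
  refine lintegral_mono_ae ?_
  filter_upwards [hψ] with z hz
  calc H z * ∫⁻ y in ball z r, ψ y ≤ H z * (M * ψ z) := by gcongr
    _ = _ := by simp only [H]; ring

theorem normPrime_nonneg {n : ℕ} (x : En n) : 0 ≤ normPrime n x := Real.sqrt_nonneg _

/-- The orthogonal projection `x ↦ (x', 0)`. -/
def projPrime (n : ℕ) : En n →ₗ[ℝ] En n where
  toFun x := WithLp.toLp 2 fun i => if (i : ℕ) + 1 < n then x i else 0
  map_add' x y := by
    ext i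
    by_cases h : (i : ℕ) + 1 < n <;> simp [h]
  map_smul' c x := by
    ext i
    by_cases h : (i : ℕ) + 1 < n <;> simp [h]

theorem projPrime_apply {n : ℕ} (x : En n) (i : Fin n) :
    projPrime n x i = if (i : ℕ) + 1 < n then x i else 0 := rfl

theorem norm_projPrime {n : ℕ} (x : En n) : ‖projPrime n x‖ = normPrime n x := by
  rw [EuclideanSpace.norm_eq, normPrime]
  congr 1
  refine Finset.sum_congr rfl fun i _ => ?_
  rw [projPrime_apply]
  split_ifs <;> simp

theorem projPrime_idem {n : ℕ} (x : En n) : projPrime n (projPrime n x) = projPrime n x := by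
  ext i
  by_cases h : (i : ℕ) + 1 < n <;> simp [projPrime_apply, h]

theorem normPrime_le_norm {n : ℕ} (x : En n) : normPrime n x ≤ ‖x‖ := by
  rw [EuclideanSpace.norm_eq, normPrime]
  refine Real.sqrt_le_sqrt (Finset.sum_le_sum fun i _ => ?_)
  split_ifs <;> simp [sq_nonneg]

theorem abs_le_normPrime {n : ℕ} (x : En n) {i : Fin n} (hi : (i : ℕ) + 1 < n) :
    |x i| ≤ normPrime n x := by
  rw [← norm_projPrime]
  have := PiLp.norm_apply_le (projPrime n x) i
  simpa [projPrime_apply, hi] using this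

theorem normPrime_sub_le {n : ℕ} (x y : En n) : normPrime n x - normPrime n y ≤ ‖x - y‖ := by
  rw [← norm_projPrime, ← norm_projPrime]
  refine (norm_sub_norm_le _ _).trans ?_
  rw [← map_sub, norm_projPrime]
  exact normPrime_le_norm _

theorem normPrime_smul {n : ℕ} {r : ℝ} (hr : 0 ≤ r) (x : En n) :
    normPrime n (r • x) = r * normPrime n x := by
  rw [← norm_projPrime, ← norm_projPrime, map_smul, norm_smul, Real.norm_of_nonneg hr]

theorem measurable_normPrime (n : ℕ) : Measurable (normPrime n) := by
  unfold normPrime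
  refine (Finset.measurable_sum _ fun i _ => ?_).sqrt
  split_ifs <;> fun_prop

theorem measurable_weight (n : ℕ) (a b : ℝ) : Measurable (weight n a b) := by
  have := measurable_normPrime n
  unfold weight
  fun_prop

theorem weight_nonneg {n : ℕ} (a b : ℝ) (x : En n) : 0 ≤ weight n a b x :=
  mul_nonneg (Real.rpow_nonneg (normPrime_nonneg x) _) (Real.rpow_nonneg (norm_nonneg x) _)

theorem weight_pos {n : ℕ} (a b : ℝ) {x : En n} (hx : 0 < normPrime n x) : 0 < weight n a b x :=
  mul_pos (Real.rpow_pos_of_pos hx _)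
    (Real.rpow_pos_of_pos (hx.trans_le (normPrime_le_norm x)) _)

theorem weight_smul {n : ℕ} (a b : ℝ) {r : ℝ} (hr : 0 < r) (x : En n) :
    weight n a b (r • x) = r ^ (a + b) * weight n a b x := by
  rw [weight, weight, normPrime_smul hr.le, norm_smul, Real.norm_of_nonneg hr.le,
    Real.mul_rpow hr.le (normPrime_nonneg x), Real.mul_rpow hr.le (norm_nonneg x),
    Real.rpow_add hr]
  ring

theorem ae_apply_ne_zero {n : ℕ} (i : Fin n) : ∀ᵐ x : En n, x i ≠ 0 := by
  have h : MeasurePreserving (fun x : En n => WithLp.ofLp x) := PiLp.volume_preserving_ofLp (Fin n)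
  have h2 := (Measure.quasiMeasurePreserving_eval (fun _ : Fin n => (volume : Measure ℝ)) i).comp
    h.quasiMeasurePreserving
  exact h2.ae (Measure.ae_ne volume 0)

theorem ae_normPrime_pos {n : ℕ} (hn : 2 ≤ n) : ∀ᵐ x : En n, 0 < normPrime n x := by
  filter_upwards [ae_apply_ne_zero (⟨0, by omega⟩ : Fin n)] with x hx
  exact (abs_pos.2 hx).trans_le (abs_le_normPrime x (by simpa using (by omega : 1 < n)))

theorem lintegral_weight_ball_zero {n : ℕ} (a b : ℝ) {r : ℝ} (hr : 0 < r) :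
    ∫⁻ x in ball (0 : En n) r, ENNReal.ofReal (weight n a b x) =
      ENNReal.ofReal (r ^ ((n : ℝ) + a + b)) *
        ∫⁻ x in ball (0 : En n) 1, ENNReal.ofReal (weight n a b x) := by
  have h := lintegral_comp_segment
    ((ball (0 : En n) r).indicator fun x => ENNReal.ofReal (weight n a b x)) 0 hr
  rw [lintegral_indicator measurableSet_ball] at h
  have h2 : ∫⁻ x : En n, ((ball (0 : En n) r).indicator fun x => ENNReal.ofReal (weight n a b x))
      (0 + r • (x - 0)) = ENNReal.ofReal (r ^ (a + b)) *
        ∫⁻ x in ball (0 : En n) 1, ENNReal.ofReal (weight n a b x) := by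
    rw [← lintegral_const_mul _ (measurable_weight n a b).ennreal_ofReal,
      ← lintegral_indicator measurableSet_ball]
    refine lintegral_congr fun x => ?_
    have : r • x ∈ ball (0 : En n) r ↔ x ∈ ball (0 : En n) 1 := by
      simp [norm_smul, abs_of_pos hr, hr]
    rw [sub_zero, zero_add]
    by_cases hx : x ∈ ball (0 : En n) 1
    · rw [indicator_of_mem hx, indicator_of_mem (this.2 hx), weight_smul a b hr,
        ENNReal.ofReal_mul (Real.rpow_nonneg hr.le _)]
    · rw [indicator_of_notMem hx, indicator_of_notMem fun h => hx (this.1 h)]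
  rw [h2] at h
  rw [add_assoc, Real.rpow_add hr, Real.rpow_natCast,
    ENNReal.ofReal_mul (by positivity), mul_assoc, h, ← mul_assoc,
    ← ENNReal.ofReal_mul (by positivity), mul_inv_cancel₀ (by positivity)]
  simp

theorem integrableOn_abs_rpow {γ : ℝ} (hγ : -1 < γ) :
    Integrable ((Icc (-1 : ℝ) 1).indicator fun x => |x| ^ γ) := by
  rw [integrable_indicator_iff measurableSet_Icc]
  have h1 : IntegrableOn (fun x : ℝ => |x| ^ γ) (Ioc 0 1) := by
    have := (intervalIntegral.intervalIntegrable_rpow' hγ (a := 0) (b := 1))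
    rw [intervalIntegrable_iff_integrableOn_Ioc_of_le zero_le_one] at this
    refine this.congr_fun (fun x hx => ?_) measurableSet_Ioc
    simp [abs_of_pos hx.1]
  have h2 : IntervalIntegrable (fun x : ℝ => |x| ^ γ) volume 0 1 :=
    (intervalIntegrable_iff_integrableOn_Ioc_of_le zero_le_one).2 h1
  have h3 : IntervalIntegrable (fun x : ℝ => |x| ^ γ) volume (-1) 0 := by
    rw [IntervalIntegrable.iff_comp_neg]
    simpa using h2.symm
  rw [integrableOn_Icc_iff_integrableOn_Ioc]
  exact (intervalIntegrable_iff_integrableOn_Ioc_of_le (by norm_num)).1 (h3.trans h2)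

theorem lintegral_prod_abs_rpow_lt_top {n : ℕ} (γ : Fin n → ℝ) (hγ : ∀ i, -1 < γ i) :
    ∫⁻ x in ball (0 : En n) 1, ENNReal.ofReal (∏ i, |x i| ^ γ i) < ∞ := by
  have hI : Integrable fun y : Fin n → ℝ =>
      ∏ i, (Icc (-1 : ℝ) 1).indicator (fun x => |x| ^ γ i) (y i) :=
    Integrable.fintype_prod fun i => integrableOn_abs_rpow (hγ i)
  have hJ := (PiLp.volume_preserving_ofLp (Fin n)).integrable_comp_of_integrable hI
  refine lt_of_le_of_lt ?_ hJ.lintegral_lt_top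
  rw [← lintegral_indicator measurableSet_ball]
  refine lintegral_mono fun x => ?_
  by_cases hx : x ∈ ball (0 : En n) 1
  · rw [indicator_of_mem hx]
    refine ENNReal.ofReal_le_ofReal (le_of_eq (Finset.prod_congr rfl fun i _ => ?_))
    have : x i ∈ Icc (-1 : ℝ) 1 :=
      abs_le.1 ((PiLp.norm_apply_le x i).trans (mem_ball_zero_iff.1 hx).le)
    exact (indicator_of_mem this (fun x : ℝ => |x| ^ γ i)).symm
  · simp [indicator_of_notMem hx]

theorem lintegral_weight_lt_top_of_nonpos {n : ℕ} (hn : 2 ≤ n) {a b : ℝ} (ha0 : a ≤ 0)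
    (hb0 : b ≤ 0) (ha : -((n : ℝ) - 1) < a) (hab : -(n : ℝ) < a + b) :
    ∫⁻ x in ball (0 : En n) 1, ENNReal.ofReal (weight n a b x) < ∞ := by
  obtain ⟨m, rfl⟩ : ∃ m, n = m + 1 := ⟨n - 1, by omega⟩
  have hm : (0 : ℝ) < m := by exact_mod_cast (by omega : 0 < m)
  push_cast at ha hab
  obtain ⟨b₁, b₂, hb, hb₁, hb₂, hab₁, hb₂'⟩ : ∃ b₁ b₂ : ℝ,
      b₁ + b₂ = b ∧ b₁ ≤ 0 ∧ b₂ ≤ 0 ∧ -(m : ℝ) < a + b₁ ∧ -1 < b₂ := by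
    set ε := min ((a + b + (m + 1)) / 2) (a + m) with hε
    have h1 : ε ≤ (a + b + (m + 1)) / 2 := min_le_left _ _
    have h2 : ε ≤ a + m := min_le_right _ _
    have h0 : 0 < ε := lt_min (by linarith) (by linarith)
    rcases le_total b (-m - a + ε) with h | h
    · exact ⟨-m - a + ε, b - (-m - a + ε), by ring, by linarith, by linarith, by linarith,
        by linarith⟩
    · exact ⟨b, 0, by ring, hb0, le_rfl, by linarith, by norm_num⟩
  set γ : Fin (m + 1) → ℝ := fun i => if (i : ℕ) < m then (a + b₁) / m else b₂ with hγdef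
  have hγ : ∀ i, -1 < γ i := by
    intro i
    simp only [hγdef]
    split_ifs
    · rw [lt_div_iff₀ hm]; linarith
    · exact hb₂'
  refine lt_of_le_of_lt (lintegral_mono_ae (ae_restrict_of_ae ?_))
    (lintegral_prod_abs_rpow_lt_top γ hγ)
  filter_upwards [ae_all_iff.2 fun i => ae_apply_ne_zero (n := m + 1) i,
    ae_normPrime_pos hn] with x hx hp
  refine ENNReal.ofReal_le_ofReal ?_
  have hx0 : 0 < ‖x‖ := hp.trans_le (normPrime_le_norm x)
  rw [Fin.prod_univ_castSucc]
  have e1 : ∀ i : Fin m, γ i.castSucc = (a + b₁) / m := fun i => by simp [hγdef]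
  have e2 : γ (Fin.last m) = b₂ := by simp [hγdef]
  simp only [e1, e2]
  calc weight (m + 1) a b x
      = normPrime (m + 1) x ^ a * ‖x‖ ^ b₁ * ‖x‖ ^ b₂ := by
        rw [weight, ← hb, Real.rpow_add hx0, mul_assoc]
    _ ≤ normPrime (m + 1) x ^ a * normPrime (m + 1) x ^ b₁ * |x (Fin.last m)| ^ b₂ := by
        have := normPrime_nonneg x
        gcongr ?_ * ?_ * ?_
        · exact Real.rpow_le_rpow_of_nonpos hp (normPrime_le_norm x) hb₁
        · exact Real.rpow_le_rpow_of_nonpos (abs_pos.2 (hx _)) (PiLp.norm_apply_le x _) hb₂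
    _ = (∏ _i : Fin m, normPrime (m + 1) x ^ ((a + b₁) / m)) * |x (Fin.last m)| ^ b₂ := by
        rw [← Real.rpow_add hp, Finset.prod_const, Finset.card_univ, Fintype.card_fin,
          ← Real.rpow_mul_natCast hp.le, div_mul_cancel₀ _ hm.ne']
    _ ≤ _ := by
        refine mul_le_mul_of_nonneg_right (Finset.prod_le_prod (fun i _ => ?_) fun i _ => ?_)
          (by positivity)
        · exact Real.rpow_nonneg hp.le _
        · exact Real.rpow_le_rpow_of_nonpos (abs_pos.2 (hx _))
            (abs_le_normPrime x (i := i.castSucc) (by simp))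
              (div_nonpos_of_nonpos_of_nonneg (by linarith) hm.le)

theorem lintegral_weight_lt_top {n : ℕ} (hn : 2 ≤ n) {a b : ℝ}
    (ha : -((n : ℝ) - 1) < a) (hab : -(n : ℝ) < a + b) :
    ∫⁻ x in ball (0 : En n) 1, ENNReal.ofReal (weight n a b x) < ∞ := by
  have hn' : (2 : ℝ) ≤ n := by exact_mod_cast hn
  have mono : ∀ a' b' : ℝ, a' ≤ 0 → b' ≤ 0 → -((n : ℝ) - 1) < a' → -(n : ℝ) < a' + b' →
      (∀ x : En n, 0 < normPrime n x → ‖x‖ < 1 → weight n a b x ≤ weight n a' b' x) →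
      ∫⁻ x in ball (0 : En n) 1, ENNReal.ofReal (weight n a b x) < ∞ := by
    intro a' b' h1 h2 h3 h4 h
    refine lt_of_le_of_lt (lintegral_mono_ae ?_) (lintegral_weight_lt_top_of_nonpos hn h1 h2 h3 h4)
    filter_upwards [ae_restrict_mem measurableSet_ball, ae_restrict_of_ae (ae_normPrime_pos hn)]
      with x hx hp
    exact ENNReal.ofReal_le_ofReal (h x hp (mem_ball_zero_iff.1 hx))
  rcases le_total a 0 with ha0 | ha0
  · rcases le_total b 0 with hb0 | hb0
    · exact lintegral_weight_lt_top_of_nonpos hn ha0 hb0 ha hab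
    · refine mono a 0 ha0 le_rfl ha (by linarith) fun x hp hx => ?_
      rw [weight, weight, Real.rpow_zero]
      have := normPrime_nonneg x
      gcongr
      exact Real.rpow_le_one (norm_nonneg x) hx.le hb0
  · have key : ∀ x : En n, 0 < normPrime n x → weight n a b x ≤ ‖x‖ ^ (a + b) := by
      intro x hp
      rw [weight, Real.rpow_add (hp.trans_le (normPrime_le_norm x))]
      gcongr
      exact normPrime_le_norm x
    rcases le_total (a + b) 0 with hs | hs
    · refine mono 0 (a + b) le_rfl hs (by linarith) (by linarith) fun x hp hx => ?_
      rw [weight.eq_1 n 0, Real.rpow_zero, one_mul]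
      exact key x hp
    · refine mono 0 0 le_rfl le_rfl (by linarith) (by linarith) fun x hp hx => ?_
      rw [weight.eq_1 n 0, Real.rpow_zero, Real.rpow_zero, one_mul]
      exact (key x hp).trans (Real.rpow_le_one (norm_nonneg x) hx.le hs)

theorem rpow_le_two_rpow_abs_mul {x y : ℝ} (hy : 0 < y) (h1 : y / 2 ≤ x) (h2 : x ≤ 2 * y) (b : ℝ) :
    x ^ b ≤ 2 ^ |b| * y ^ b := by
  have hx : 0 < x := (half_pos hy).trans_le h1
  rcases le_total 0 b with hb | hb
  · rw [abs_of_nonneg hb, ← Real.mul_rpow zero_le_two hy.le]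
    exact Real.rpow_le_rpow hx.le h2 hb
  · rw [abs_of_nonpos hb, Real.rpow_neg zero_le_two, ← Real.inv_rpow zero_le_two,
      ← Real.mul_rpow (by norm_num) hy.le, inv_mul_eq_div]
    exact Real.rpow_le_rpow_of_nonpos (half_pos hy) h1 hb

/-- If `r ≥ d / 2` and `s ≤ 0`, a radius-`3r` scaling factor is controlled by `r ^ n * d ^ s`. -/
theorem three_mul_rpow_le (n : ℕ) {r d s : ℝ} (hr : 0 < r) (hd : 0 < d) (h : d / 2 ≤ r)
    (hs : s ≤ 0) : (3 * r) ^ ((n : ℝ) + s) ≤ 3 ^ n * 2 ^ |s| * (r ^ n * d ^ s) := by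
  have h3 : (3 * r) ^ s ≤ 2 ^ |s| * d ^ s :=
    (Real.rpow_le_rpow_of_nonpos (half_pos hd) (by linarith) hs).trans
      (rpow_le_two_rpow_abs_mul hd le_rfl (by linarith) s)
  rw [Real.rpow_add (by positivity), Real.rpow_natCast, mul_pow]
  calc 3 ^ n * r ^ n * (3 * r) ^ s ≤ 3 ^ n * r ^ n * (2 ^ |s| * d ^ s) := by gcongr
    _ = _ := by ring

theorem volume_ball_eq {n : ℕ} (y : En n) {r : ℝ} (hr : 0 < r) :
    volume (ball y r) = ENNReal.ofReal (r ^ n) * volume (ball (0 : En n) 1) := by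
  rw [Measure.addHaar_ball_of_pos _ _ hr, finrank_euclideanSpace_fin]

theorem lintegral_normPrime_rpow_ball_le {n : ℕ} (hn : 2 ≤ n) {a : ℝ}
    (ha : -((n : ℝ) - 1) < a) (ha0 : a ≤ 0) :
    ∃ K : ℝ≥0∞, K ≠ ∞ ∧ ∀ r : ℝ, 0 < r → ∀ y : En n, 0 < normPrime n y →
      ∫⁻ x in ball y r, ENNReal.ofReal (normPrime n x ^ a) ≤
        K * ENNReal.ofReal (r ^ n * normPrime n y ^ a) := by
  set V := volume (ball (0 : En n) 1)
  set K₀ := ∫⁻ x in ball (0 : En n) 1, ENNReal.ofReal (weight n a 0 x)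
  have hw : ∀ x : En n, normPrime n x ^ a = weight n a 0 x := fun x => by simp [weight]
  have hV : V ≠ ∞ := measure_ball_lt_top.ne
  have hK₀ : K₀ ≠ ∞ := (lintegral_weight_lt_top hn ha (by linarith)).ne
  refine ⟨ENNReal.ofReal (2 ^ |a|) * V + ENNReal.ofReal (3 ^ n * 2 ^ |a|) * K₀,
    by finiteness, fun r hr y hy => ?_⟩
  rw [add_mul]
  rcases le_or_gt r (normPrime n y / 2) with h | h
  · refine le_trans ?_ le_self_add
    calc ∫⁻ x in ball y r, ENNReal.ofReal (normPrime n x ^ a)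
        ≤ ∫⁻ x in ball y r, ENNReal.ofReal (2 ^ |a| * normPrime n y ^ a) := by
          refine setLIntegral_mono measurable_const fun x hx => ENNReal.ofReal_le_ofReal ?_
          have h1 := normPrime_sub_le x y
          have h2 := normPrime_sub_le y x
          rw [norm_sub_rev] at h2
          have h3 := mem_ball_iff_norm.1 hx
          exact rpow_le_two_rpow_abs_mul hy (by linarith) (by linarith) a
      _ = _ := by
          rw [setLIntegral_const, volume_ball_eq y hr,
            ENNReal.ofReal_mul (by positivity : (0 : ℝ) ≤ 2 ^ |a|),
            ENNReal.ofReal_mul (by positivity : (0 : ℝ) ≤ r ^ n)]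
          ring
  · refine le_trans ?_ le_add_self
    set v := y - projPrime n y
    have hv : ∀ x, normPrime n (x + v) = normPrime n x := fun x => by
      rw [← norm_projPrime, ← norm_projPrime, map_add, map_sub, projPrime_idem, sub_self,
        add_zero]
    calc ∫⁻ x in ball y r, ENNReal.ofReal (normPrime n x ^ a)
        = ∫⁻ x, (ball y r).indicator (fun x => ENNReal.ofReal (normPrime n x ^ a)) (x + v) := by
          rw [← lintegral_indicator measurableSet_ball]
          exact (lintegral_add_right_eq_self (μ := (volume : Measure (En n))) _ v).symm
      _ ≤ ∫⁻ x, (ball (0 : En n) (3 * r)).indicator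
            (fun x => ENNReal.ofReal (weight n a 0 x)) x := by
          refine lintegral_mono fun x => ?_
          by_cases hx : x + v ∈ ball y r
          · have hx' : x ∈ ball (0 : En n) (3 * r) := by
              rw [mem_ball_iff_norm] at hx
              have e : x + v - y = x - projPrime n y := by simp only [v]; abel
              rw [e] at hx
              have := norm_le_norm_sub_add x (projPrime n y)
              rw [norm_projPrime] at this
              rw [mem_ball_zero_iff]
              linarith
            rw [indicator_of_mem hx, indicator_of_mem hx', hv, hw]
          · rw [indicator_of_notMem hx]
            exact zero_le
      _ = ENNReal.ofReal ((3 * r) ^ ((n : ℝ) + a)) * K₀ := by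
          rw [lintegral_indicator measurableSet_ball,
            lintegral_weight_ball_zero a 0 (by positivity), add_zero]
      _ ≤ ENNReal.ofReal (3 ^ n * 2 ^ |a| * (r ^ n * normPrime n y ^ a)) * K₀ := by
          gcongr
          exact three_mul_rpow_le n hr hy h.le ha0
      _ = _ := by
          rw [ENNReal.ofReal_mul (by positivity)]
          ring

/-- The `A₁` condition for the anisotropic weight in the range where it holds. -/
theorem lintegral_weight_ball_le {n : ℕ} (hn : 2 ≤ n) {a b : ℝ}
    (ha : -((n : ℝ) - 1) < a) (ha0 : a ≤ 0) (hs : -(n : ℝ) < a + b) (hs0 : a + b ≤ 0) :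
    ∃ K : ℝ≥0∞, K ≠ ∞ ∧ ∀ r : ℝ, 0 < r → ∀ y : En n, 0 < normPrime n y →
      ∫⁻ x in ball y r, ENNReal.ofReal (weight n a b x) ≤
        K * ENNReal.ofReal (r ^ n) * ENNReal.ofReal (weight n a b y) := by
  obtain ⟨K₁, hK₁, hK⟩ := lintegral_normPrime_rpow_ball_le hn ha ha0
  set K₀ := ∫⁻ x in ball (0 : En n) 1, ENNReal.ofReal (weight n a b x)
  have hK₀ : K₀ ≠ ∞ := (lintegral_weight_lt_top hn ha hs).ne
  refine ⟨ENNReal.ofReal (2 ^ |b|) * K₁ + ENNReal.ofReal (3 ^ n * 2 ^ |a + b|) * K₀,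
    by finiteness, fun r hr y hy => ?_⟩
  have hy' : 0 < ‖y‖ := hy.trans_le (normPrime_le_norm y)
  have hm := measurable_normPrime n
  rw [add_mul, add_mul]
  rcases le_or_gt r (‖y‖ / 2) with h | h
  · refine le_trans ?_ le_self_add
    calc ∫⁻ x in ball y r, ENNReal.ofReal (weight n a b x)
        ≤ ∫⁻ x in ball y r,
            ENNReal.ofReal (2 ^ |b| * ‖y‖ ^ b) * ENNReal.ofReal (normPrime n x ^ a) := by
          refine setLIntegral_mono (by fun_prop) fun x hx => ?_
          rw [← ENNReal.ofReal_mul (by positivity), weight, mul_comm]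
          refine ENNReal.ofReal_le_ofReal ?_
          have h1 := norm_sub_norm_le x y
          have h2 := norm_sub_norm_le y x
          rw [norm_sub_rev] at h2
          have h3 := mem_ball_iff_norm.1 hx
          have := Real.rpow_nonneg (normPrime_nonneg x) a
          gcongr
          exact rpow_le_two_rpow_abs_mul hy' (by linarith) (by linarith) b
      _ ≤ ENNReal.ofReal (2 ^ |b| * ‖y‖ ^ b) *
            (K₁ * ENNReal.ofReal (r ^ n * normPrime n y ^ a)) := by
          rw [lintegral_const_mul _ (by fun_prop)]
          gcongr
          exact hK r hr y hy
      _ = _ := by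
          rw [weight, ENNReal.ofReal_mul (by positivity : (0 : ℝ) ≤ 2 ^ |b|),
            ENNReal.ofReal_mul (by positivity : (0 : ℝ) ≤ r ^ n),
            ENNReal.ofReal_mul (Real.rpow_nonneg hy.le a)]
          ring
  · refine le_trans ?_ le_add_self
    calc ∫⁻ x in ball y r, ENNReal.ofReal (weight n a b x)
        ≤ ∫⁻ x in ball (0 : En n) (3 * r), ENNReal.ofReal (weight n a b x) := by
          refine lintegral_mono_set (ball_subset_ball' ?_)
          rw [dist_zero_right]
          linarith
      _ ≤ ENNReal.ofReal (3 ^ n * 2 ^ |a + b| * (r ^ n * weight n a b y)) * K₀ := by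
          rw [lintegral_weight_ball_zero a b (by positivity), add_assoc]
          gcongr
          refine (three_mul_rpow_le n hr hy' h.le hs0).trans ?_
          gcongr
          rw [weight, Real.rpow_add hy']
          refine mul_le_mul_of_nonneg_right ?_ (by positivity)
          exact Real.rpow_le_rpow_of_nonpos hy (normPrime_le_norm y) ha0
      _ = _ := by
          rw [ENNReal.ofReal_mul (by positivity : (0 : ℝ) ≤ 3 ^ n * 2 ^ |a + b|),
            ENNReal.ofReal_mul (by positivity : (0 : ℝ) ≤ r ^ n)]
          ring

theorem ofReal_sub_le_lintegral_segment {n : ℕ} {u : En n → ℝ} (hu : ContDiff ℝ 1 u) {R m l : ℝ}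
    {x y : En n} (hx : x ∈ ball (0 : En n) R) (hy : y ∈ ball (0 : En n) R) (hxm : u x ≤ m)
    (hyl : l ≤ u y) :
    ENNReal.ofReal (l - m) ≤ ENNReal.ofReal (2 * R) * ∫⁻ t in Ioo (0 : ℝ) 1,
      {z ∈ ball (0 : En n) R | m < u z ∧ u z < l}.indicator
        (fun z => ENNReal.ofReal ‖gradient u z‖) (y + t • (x - y)) := by
  set S := {z ∈ ball (0 : En n) R | m < u z ∧ u z < l}
  have hR : 0 < R := pos_of_mem_ball hx
  have hd : ∀ t : ℝ, HasDerivAt (fun t : ℝ => u (y + t • (x - y)))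
      (fderiv ℝ u (y + t • (x - y)) (x - y)) t := fun t => by
    have h1 : HasDerivAt (fun t : ℝ => y + t • (x - y)) (x - y) t := by
      simpa using ((hasDerivAt_id t).smul_const (x - y)).const_add y
    exact ((hu.differentiable one_ne_zero _).hasFDerivAt).comp_hasDerivAt t h1
  have key := ofReal_sub_le_lintegral_abs_deriv hd (m := m) (l := l) (by simpa using hyl)
    (by simpa using hxm)
  have hc : Continuous fun t : ℝ => u (y + t • (x - y)) :=
    hu.continuous.comp (by fun_prop)
  have hT : MeasurableSet {t ∈ Ioo (0 : ℝ) 1 | m < u (y + t • (x - y)) ∧ u (y + t • (x - y)) < l} :=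
    measurableSet_Ioo.inter
      ((isOpen_lt continuous_const hc).inter (isOpen_lt hc continuous_const)).measurableSet
  refine key.trans ?_
  rw [← lintegral_const_mul' _ _ ENNReal.ofReal_ne_top, ← lintegral_indicator hT,
    ← lintegral_indicator measurableSet_Ioo]
  refine lintegral_mono fun t => ?_
  by_cases ht : t ∈ {t ∈ Ioo (0 : ℝ) 1 | m < u (y + t • (x - y)) ∧ u (y + t • (x - y)) < l}
  · have hz : y + t • (x - y) ∈ S :=
      ⟨(convex_ball (0 : En n) R).add_smul_sub_mem hy hx ⟨ht.1.1.le, ht.1.2.le⟩, ht.2⟩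
    rw [indicator_of_mem ht, indicator_of_mem ht.1, indicator_of_mem hz,
      ← ENNReal.ofReal_mul (by positivity)]
    refine ENNReal.ofReal_le_ofReal ?_
    rw [← inner_gradient_left, mul_comm]
    refine (abs_real_inner_le_norm _ _).trans ?_
    gcongr
    have h1 := norm_sub_le x y
    have h2 := mem_ball_zero_iff.1 hx
    have h3 := mem_ball_zero_iff.1 hy
    linarith
  · rw [indicator_of_notMem ht]
    exact zero_le

theorem measurable_norm_gradient {n : ℕ} {u : En n → ℝ} (hu : ContDiff ℝ 1 u) :
    Measurable fun z => ‖gradient u z‖ := by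
  have h : (fun z => ‖gradient u z‖) = fun z => ‖fderiv ℝ u z‖ := by
    ext z
    simp [gradient]
  rw [h]
  exact (hu.continuous_fderiv one_ne_zero).norm.measurable

theorem measurableSet_level {n : ℕ} {u : En n → ℝ} (hu : Continuous u) (R m l : ℝ) :
    MeasurableSet {z ∈ ball (0 : En n) R | m < u z ∧ u z < l} :=
  measurableSet_ball.inter
    ((isOpen_lt continuous_const hu).inter (isOpen_lt hu continuous_const)).measurableSet

/-- The segment averaging operator over the sets `D y` is bounded on `L^q (w)` of the ball of
radius `R`, and every set `D y` meets any half of the ball in a fixed proportion of it. -/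
structure SegmentAveraging {n : ℕ} (q : ℝ) (w : En n → ℝ≥0∞) (K : ℝ≥0∞) (R : ℝ)
    (D : En n → Set (En n)) : Prop where
  measurableSet : ∀ y, MeasurableSet (D y)
  volume_le : ∀ y ∈ ball (0 : En n) R, ∀ E ⊆ ball (0 : En n) R, MeasurableSet E →
    volume (ball (0 : En n) R) ≤ 2 * volume E → volume (ball (0 : En n) R) ≤ 8 * volume (E ∩ D y)
  bound : ∀ G : En n → ℝ≥0∞, Measurable G →
    ∫⁻ y in ball (0 : En n) R, w y *
      (∫⁻ x in ball (0 : En n) R ∩ D y, ∫⁻ t in Ioo (0 : ℝ) 1, G (y + t • (x - y))) ^ q ≤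
    K * volume (ball (0 : En n) R) ^ q * ∫⁻ z, w z * G z ^ q

theorem SegmentAveraging.level_set_le {n : ℕ} {q : ℝ} (hq : 1 < q) {w : En n → ℝ≥0∞} {K : ℝ≥0∞}
    {R : ℝ} {D : En n → Set (En n)} (h : SegmentAveraging q w K R D) (hR : 0 < R)
    {u : En n → ℝ} (hu : ContDiff ℝ 1 u) {m l : ℝ}
    (hm : volume (ball (0 : En n) R) ≤ 2 * volume {x ∈ ball (0 : En n) R | u x ≤ m}) :
    ENNReal.ofReal (l - m) ^ q * ∫⁻ y in {x ∈ ball (0 : En n) R | l ≤ u x}, w y ≤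
      ENNReal.ofReal (16 * R) ^ q * K *
        ∫⁻ z in {z ∈ ball (0 : En n) R | m < u z ∧ u z < l},
          w z * ENNReal.ofReal (‖gradient u z‖ ^ q) := by
  have hq0 : 0 ≤ q := by linarith
  set B := ball (0 : En n) R
  set E := {x ∈ B | u x ≤ m}
  set F := {x ∈ B | l ≤ u x}
  set S := {z ∈ B | m < u z ∧ u z < l}
  set G : En n → ℝ≥0∞ := S.indicator fun z => ENNReal.ofReal ‖gradient u z‖
  have hS : MeasurableSet S := measurableSet_level hu.continuous R m l
  have hG : Measurable G := (measurable_norm_gradient hu).ennreal_ofReal.indicator hS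
  have hE : MeasurableSet E :=
    measurableSet_ball.inter (isClosed_le hu.continuous continuous_const).measurableSet
  have hF : MeasurableSet F :=
    measurableSet_ball.inter (isClosed_le continuous_const hu.continuous).measurableSet
  have hV0 : volume B ≠ 0 := (measure_ball_pos volume 0 hR).ne'
  have hVt : volume B ≠ ∞ := measure_ball_lt_top.ne
  set T : En n → ℝ≥0∞ := fun y => ∫⁻ x in B ∩ D y, ∫⁻ t in Ioo (0 : ℝ) 1, G (y + t • (x - y))
  have pt : ∀ y ∈ F, ENNReal.ofReal (l - m) * volume B ≤ ENNReal.ofReal (16 * R) * T y := by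
    intro y hy
    calc ENNReal.ofReal (l - m) * volume B
        ≤ ENNReal.ofReal (l - m) * (8 * volume (E ∩ D y)) := by
          gcongr
          exact h.volume_le y hy.1 E (fun x hx => hx.1) hE hm
      _ = 8 * ∫⁻ x in E ∩ D y, ENNReal.ofReal (l - m) := by rw [setLIntegral_const]; ring
      _ ≤ 8 * ∫⁻ x in E ∩ D y, ENNReal.ofReal (2 * R) *
            ∫⁻ t in Ioo (0 : ℝ) 1, G (y + t • (x - y)) := by
          gcongr 8 * ?_
          exact setLIntegral_mono' (hE.inter (h.measurableSet y)) fun x hx =>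
            ofReal_sub_le_lintegral_segment hu hx.1.1 hy.1 hx.1.2 hy.2
      _ ≤ 8 * (ENNReal.ofReal (2 * R) * T y) := by
          rw [lintegral_const_mul' _ _ ENNReal.ofReal_ne_top]
          gcongr
          exact lintegral_mono_set (inter_subset_inter_left _ fun x hx => hx.1)
      _ = ENNReal.ofReal (16 * R) * T y := by
          rw [← mul_assoc, show (16 : ℝ) * R = 8 * (2 * R) by ring,
            ENNReal.ofReal_mul (by norm_num : (0 : ℝ) ≤ 8)]
          simp
  have hGq : ∫⁻ z, w z * G z ^ q = ∫⁻ z in S, w z * ENNReal.ofReal (‖gradient u z‖ ^ q) := by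
    rw [← lintegral_indicator hS]
    refine lintegral_congr fun z => ?_
    by_cases hz : z ∈ S
    · simp only [G, indicator_of_mem hz]
      rw [ENNReal.ofReal_rpow_of_nonneg (norm_nonneg _) hq0]
    · simp only [G, indicator_of_notMem hz]
      rw [ENNReal.zero_rpow_of_pos (by linarith), mul_zero]
  have main : volume B ^ q * (ENNReal.ofReal (l - m) ^ q * ∫⁻ y in F, w y) ≤
      volume B ^ q * (ENNReal.ofReal (16 * R) ^ q * K *
        ∫⁻ z in S, w z * ENNReal.ofReal (‖gradient u z‖ ^ q)) := by
    calc volume B ^ q * (ENNReal.ofReal (l - m) ^ q * ∫⁻ y in F, w y)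
        = ∫⁻ y in F, (ENNReal.ofReal (l - m) * volume B) ^ q * w y := by
          rw [lintegral_const_mul' _ _ (by finiteness), ENNReal.mul_rpow_of_nonneg _ _ hq0]
          ring
      _ ≤ ∫⁻ y in F, ENNReal.ofReal (16 * R) ^ q * (w y * T y ^ q) := by
          refine setLIntegral_mono' hF fun y hy => ?_
          rw [mul_left_comm, ← ENNReal.mul_rpow_of_nonneg _ _ hq0, mul_comm]
          exact mul_le_mul_right (ENNReal.rpow_le_rpow (pt y hy) hq0) (w y)
      _ ≤ ENNReal.ofReal (16 * R) ^ q * ∫⁻ y in B, w y * T y ^ q := by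
          rw [lintegral_const_mul' _ _ (by finiteness)]
          gcongr
          exact fun x hx => hx.1
      _ ≤ ENNReal.ofReal (16 * R) ^ q * (K * volume B ^ q * ∫⁻ z, w z * G z ^ q) := by
          gcongr
          exact h.bound G hG
      _ = _ := by rw [hGq]; ring
  refine (ENNReal.mul_le_mul_iff_right ?_ (by finiteness)).1 main
  exact (ENNReal.rpow_pos (pos_iff_ne_zero.2 hV0) hVt).ne'

theorem muW_apply {n : ℕ} (θ1 θ2 : ℝ) {s : Set (En n)} (hs : MeasurableSet s) :
    muW n θ1 θ2 s = ∫⁻ x in s, ENNReal.ofReal (weight n θ1 θ2 x) :=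
  withDensity_apply _ hs

/-- The isoperimetric inequality follows from boundedness of segment averages. -/
theorem isoperimetric_of_segmentAveraging {n : ℕ} (hn : 2 ≤ n) {q θ1 θ2 : ℝ} (hq : 1 < q)
    (h1 : -((n : ℝ) - 1) < θ1) (h12 : -(n : ℝ) < θ1 + θ2) {K : ℝ≥0∞} (hK : K ≠ ∞)
    (h : ∀ R : ℝ, 0 < R → ∃ D : En n → Set (En n),
      SegmentAveraging q (fun x => ENNReal.ofReal (weight n θ1 θ2 x)) K R D) :
    ∃ C : ℝ, 0 < C ∧ ∀ (R : ℝ), 0 < R → ∀ k l : ℝ, k < l → ∀ u : En n → ℝ,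
      ContDiff ℝ 1 u →
      ENNReal.ofReal ((l - k) ^ q) *
          (muW n θ1 θ2 {x ∈ ball (0 : En n) R | u x ≤ k}) ^ q *
          muW n θ1 θ2 {x ∈ ball (0 : En n) R | l ≤ u x}
      ≤ ENNReal.ofReal (C * R ^ (q * ((n : ℝ) + θ1 + θ2 + 1))) *
          ∫⁻ x in {x ∈ ball (0 : En n) R | k < u x ∧ u x < l},
            ENNReal.ofReal (‖gradient u x‖ ^ q) ∂(muW n θ1 θ2) := by
  have hq0 : 0 ≤ q := by linarith
  set K₁ := ∫⁻ x in ball (0 : En n) 1, ENNReal.ofReal (weight n θ1 θ2 x)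
  have hK₁ : K₁ ≠ ∞ := (lintegral_weight_lt_top hn h1 h12).ne
  set N : ℝ≥0∞ := ENNReal.ofReal 32 ^ q * K * K₁ ^ q
  have hN : N ≠ ∞ := by finiteness
  refine ⟨N.toReal + 1, by positivity, fun R hR k l hkl u hu => ?_⟩
  obtain ⟨D, hD⟩ := h R hR
  set B := ball (0 : En n) R
  set μ := muW n θ1 θ2
  set w : En n → ℝ≥0∞ := fun x => ENNReal.ofReal (weight n θ1 θ2 x)
  have hw : Measurable w := (measurable_weight n θ1 θ2).ennreal_ofReal
  set A := {x ∈ B | u x ≤ k}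
  set F := {x ∈ B | l ≤ u x}
  have hA : MeasurableSet A :=
    measurableSet_ball.inter (isClosed_le hu.continuous continuous_const).measurableSet
  have hF : MeasurableSet F :=
    measurableSet_ball.inter (isClosed_le continuous_const hu.continuous).measurableSet
  have hI : ∫⁻ x in {x ∈ B | k < u x ∧ u x < l}, ENNReal.ofReal (‖gradient u x‖ ^ q) ∂μ =
      ∫⁻ z in {x ∈ B | k < u x ∧ u x < l}, w z * ENNReal.ofReal (‖gradient u z‖ ^ q) :=
    setLIntegral_withDensity_eq_setLIntegral_mul _ hw
      ((measurable_norm_gradient hu).pow_const q).ennreal_ofReal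
      (measurableSet_level hu.continuous R k l)
  rw [hI]
  set I := ∫⁻ z in {x ∈ B | k < u x ∧ u x < l}, w z * ENNReal.ofReal (‖gradient u z‖ ^ q)
  set M := ENNReal.ofReal (R ^ ((n : ℝ) + θ1 + θ2)) * K₁ with hM
  have hμB : μ B = M := by
    rw [muW_apply _ _ measurableSet_ball, hM, ← lintegral_weight_ball_zero θ1 θ2 hR]
  have hAM : μ A ≤ M := hμB ▸ measure_mono fun x hx => hx.1
  have hFM : μ F ≤ M := hμB ▸ measure_mono fun x hx => hx.1
  have half : ENNReal.ofReal ((l - k) / 2) ^ q * (μ A ^ q * μ F) ≤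
      M ^ q * (ENNReal.ofReal (16 * R) ^ q * K * I) := by
    set m := (k + l) / 2 with hm
    have hcover : volume B ≤
        volume {x ∈ B | u x ≤ m} + volume {x ∈ B | m ≤ u x} := by
      refine (measure_mono fun x hx => ?_).trans (measure_union_le _ _)
      exact (le_total (u x) m).imp (fun h => ⟨hx, h⟩) fun h => ⟨hx, h⟩
    rcases le_total (volume {x ∈ B | u x ≤ m}) (volume {x ∈ B | m ≤ u x}) with hle | hle
    · have hu' : ContDiff ℝ 1 fun x => -u x := hu.neg
      have hgrad : ∀ z, ‖gradient (fun x => -u x) z‖ = ‖gradient u z‖ := fun z => by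
        simp [gradient]
      have hlev := hD.level_set_le hq hR hu' (m := -m) (l := -k) (by
        simp only [neg_le_neg_iff]
        rw [two_mul]
        exact hcover.trans (by gcongr))
      simp only [neg_le_neg_iff, neg_lt_neg_iff, hgrad] at hlev
      rw [← muW_apply θ1 θ2 hA, show -k - -m = (l - k) / 2 by rw [hm]; ring] at hlev
      calc ENNReal.ofReal ((l - k) / 2) ^ q * (μ A ^ q * μ F)
          = ENNReal.ofReal ((l - k) / 2) ^ q * (μ A ^ (q - 1) * μ A * μ F) := by
            rw [rpow_sub_one_mul_self hq]
        _ ≤ ENNReal.ofReal ((l - k) / 2) ^ q * (M ^ (q - 1) * μ A * M) := by gcongr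
        _ = (M ^ (q - 1) * M) * (ENNReal.ofReal ((l - k) / 2) ^ q * μ A) := by ring
        _ = M ^ q * (ENNReal.ofReal ((l - k) / 2) ^ q * μ A) := by
            rw [rpow_sub_one_mul_self hq]
        _ ≤ _ := by
            refine mul_le_mul_right (hlev.trans ?_) _
            gcongr
            exact lintegral_mono_set fun x hx => ⟨hx.1, hx.2.2, hx.2.1.trans (by linarith)⟩
    · have hlev := hD.level_set_le hq hR hu (m := m) (l := l) (by
        rw [two_mul]
        exact hcover.trans (by gcongr))
      rw [← muW_apply θ1 θ2 hF, show l - m = (l - k) / 2 by rw [hm]; ring] at hlev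
      calc ENNReal.ofReal ((l - k) / 2) ^ q * (μ A ^ q * μ F)
          ≤ ENNReal.ofReal ((l - k) / 2) ^ q * (M ^ q * μ F) := by gcongr
        _ = M ^ q * (ENNReal.ofReal ((l - k) / 2) ^ q * μ F) := by ring
        _ ≤ _ := by
            refine mul_le_mul_right (hlev.trans ?_) _
            gcongr
            exact lintegral_mono_set fun x hx => ⟨hx.1, lt_trans (by linarith) hx.2.1, hx.2.2⟩
  have e1 : ENNReal.ofReal ((l - k) ^ q) =
      ENNReal.ofReal 2 ^ q * ENNReal.ofReal ((l - k) / 2) ^ q := by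
    rw [← ENNReal.mul_rpow_of_nonneg _ _ hq0, ← ENNReal.ofReal_mul zero_le_two,
      mul_div_cancel₀ _ two_ne_zero, ENNReal.ofReal_rpow_of_nonneg (by linarith) hq0]
  calc ENNReal.ofReal ((l - k) ^ q) * μ A ^ q * μ F
      = ENNReal.ofReal 2 ^ q * (ENNReal.ofReal ((l - k) / 2) ^ q * (μ A ^ q * μ F)) := by
        rw [e1]; ring
    _ ≤ ENNReal.ofReal 2 ^ q * (M ^ q * (ENNReal.ofReal (16 * R) ^ q * K * I)) := by gcongr
    _ = N * ENNReal.ofReal (R ^ (q * ((n : ℝ) + θ1 + θ2 + 1))) * I := by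
        have e2 : ENNReal.ofReal (R ^ (q * ((n : ℝ) + θ1 + θ2 + 1))) =
            ENNReal.ofReal (R ^ ((n : ℝ) + θ1 + θ2)) ^ q * ENNReal.ofReal R ^ q := by
          rw [← ENNReal.mul_rpow_of_nonneg _ _ hq0, ← ENNReal.ofReal_mul (by positivity),
            ENNReal.ofReal_rpow_of_nonneg (by positivity) hq0, mul_comm q, Real.rpow_mul hR.le,
            Real.rpow_add_one hR.ne']
        have e3 : ENNReal.ofReal 32 ^ q = ENNReal.ofReal 2 ^ q * ENNReal.ofReal 16 ^ q := by
          rw [← ENNReal.mul_rpow_of_nonneg _ _ hq0, ← ENNReal.ofReal_mul zero_le_two]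
          norm_num
        rw [e2, hM, ENNReal.mul_rpow_of_nonneg _ _ hq0,
          ENNReal.ofReal_mul (by norm_num : (0 : ℝ) ≤ 16), ENNReal.mul_rpow_of_nonneg _ _ hq0]
        simp only [N, e3]
        ring
    _ ≤ _ := by
        rw [ENNReal.ofReal_mul (by positivity)]
        gcongr
        rw [ENNReal.ofReal_add (by positivity) zero_le_one, ENNReal.ofReal_toReal hN]
        exact le_self_add

theorem lintegral_Ioo_rpow_le {q : ℝ} (hq : 1 < q) {f : ℝ → ℝ≥0∞} (hf : Measurable f) :
    (∫⁻ t in Ioo (0 : ℝ) 1, f t) ^ q ≤ ∫⁻ t in Ioo (0 : ℝ) 1, f t ^ q := by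
  simpa using lintegral_rpow_le_measure_rpow_mul (volume.restrict (Ioo (0 : ℝ) 1)) hq
    hf.aemeasurable

theorem lintegral_segment_ball_le {n : ℕ} {G : En n → ℝ≥0∞} {R t : ℝ}
    (ht : 0 < t) {y : En n} (hy : y ∈ ball (0 : En n) R) :
    ∫⁻ x in ball (0 : En n) R, G (y + t • (x - y)) ≤
      ENNReal.ofReal (t ^ n)⁻¹ * ∫⁻ z in ball y (2 * t * R), G z := by
  rw [← lintegral_indicator measurableSet_ball, ← lintegral_indicator measurableSet_ball,
    ← lintegral_comp_segment _ y ht]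
  refine lintegral_mono fun x => ?_
  by_cases hx : x ∈ ball (0 : En n) R
  · have hz : y + t • (x - y) ∈ ball y (2 * t * R) := by
      rw [mem_ball_iff_norm, add_sub_cancel_left, norm_smul, Real.norm_of_nonneg ht.le]
      have h1 := norm_sub_le x y
      have h2 := mem_ball_zero_iff.1 hx
      have h3 := mem_ball_zero_iff.1 hy
      nlinarith
    rw [indicator_of_mem hx, indicator_of_mem hz]
  · rw [indicator_of_notMem hx]
    exact zero_le

/-- Segment averages are bounded for weights that factor through two `A₁` weights. -/
theorem segmentAveraging_of_factorization {n : ℕ} {q : ℝ} (hq : 1 < q)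
    {w φ ψ : En n → ℝ≥0∞} (hwm : Measurable w) (hφm : Measurable φ) (hψm : Measurable ψ)
    (hw : ∀ᵐ y, w y = ψ y * φ y ^ (1 - q))
    (hφ0 : ∀ᵐ y, φ y ≠ 0) (hφt : ∀ᵐ y, φ y ≠ ∞) {K : ℝ≥0∞}
    (hφ : ∀ r : ℝ, 0 < r → ∀ᵐ y, ∫⁻ z in ball y r, φ z ≤ K * ENNReal.ofReal (r ^ n) * φ y)
    (hψ : ∀ r : ℝ, 0 < r → ∀ᵐ y, ∫⁻ z in ball y r, ψ z ≤ K * ENNReal.ofReal (r ^ n) * ψ y)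
    {R : ℝ} (hR : 0 < R) :
    SegmentAveraging q w ((K * ENNReal.ofReal (2 ^ n) / volume (ball (0 : En n) 1)) ^ q) R
      fun _ => univ where
  measurableSet _ := MeasurableSet.univ
  volume_le y _ E _ _ h := by
    rw [inter_univ]
    refine h.trans ?_
    gcongr
    norm_num
  bound G hG := by
    have hq0 : 0 ≤ q := by linarith
    set B := ball (0 : En n) R
    set V := volume (ball (0 : En n) 1)
    have hV0 : V ≠ 0 := (measure_ball_pos volume 0 one_pos).ne'
    have hVt : V ≠ ∞ := measure_ball_lt_top.ne
    set J : ℝ → En n → ℝ≥0∞ := fun t y => ∫⁻ x in B, G (y + t • (x - y))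
    have hJ : Measurable fun p : En n × ℝ => J p.2 p.1 := by
      have : Measurable fun p : (En n × ℝ) × En n => G (p.1.1 + p.1.2 • (p.2 - p.1.1)) := by
        fun_prop
      exact this.lintegral_prod_right'
    have hswap : ∀ y, ∫⁻ x in B ∩ univ, ∫⁻ t in Ioo (0 : ℝ) 1, G (y + t • (x - y)) =
        ∫⁻ t in Ioo (0 : ℝ) 1, J t y := by
      intro y
      rw [inter_univ]
      refine lintegral_lintegral_swap (Measurable.aemeasurable ?_)
      have : Measurable fun p : En n × ℝ => G (y + p.2 • (p.1 - y)) := by fun_prop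
      exact this
    have hslice : ∀ t ∈ Ioo (0 : ℝ) 1, ∫⁻ y in B, w y * J t y ^ q ≤
        (K * ENNReal.ofReal (2 ^ n) / V) ^ q * volume B ^ q * ∫⁻ z, w z * G z ^ q := by
      intro t ht
      have hr : 0 < 2 * t * R := by have := ht.1; positivity
      have hcon : ENNReal.ofReal (t ^ n)⁻¹ * (K * ENNReal.ofReal ((2 * t * R) ^ n)) =
          K * ENNReal.ofReal (2 ^ n) / V * volume B := by
        rw [volume_ball_eq 0 hR, ENNReal.div_eq_inv_mul, mul_pow, mul_pow,
          ENNReal.ofReal_mul (by have := ht.1; positivity),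
          ENNReal.ofReal_mul (by positivity : (0 : ℝ) ≤ 2 ^ n)]
        have e1 : ENNReal.ofReal (t ^ n)⁻¹ * ENNReal.ofReal (t ^ n) = 1 := by
          have := ht.1
          rw [← ENNReal.ofReal_mul (by positivity), inv_mul_cancel₀ (by positivity),
            ENNReal.ofReal_one]
        have e2 : V⁻¹ * V = 1 := ENNReal.inv_mul_cancel hV0 hVt
        calc _ = (ENNReal.ofReal (t ^ n)⁻¹ * ENNReal.ofReal (t ^ n)) *
              (K * ENNReal.ofReal (2 ^ n) * ENNReal.ofReal (R ^ n)) := by ring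
          _ = (V⁻¹ * V) * (K * ENNReal.ofReal (2 ^ n) * ENNReal.ofReal (R ^ n)) := by rw [e1, e2]
          _ = _ := by ring
      calc ∫⁻ y in B, w y * J t y ^ q
          ≤ ∫⁻ y in B, ENNReal.ofReal (t ^ n)⁻¹ ^ q *
              (w y * (∫⁻ z in ball y (2 * t * R), G z) ^ q) := by
            refine setLIntegral_mono' measurableSet_ball fun y hy => ?_
            rw [mul_left_comm, ← ENNReal.mul_rpow_of_nonneg _ _ hq0]
            exact mul_le_mul_right
              (ENNReal.rpow_le_rpow (lintegral_segment_ball_le ht.1 hy) hq0) _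
        _ ≤ ENNReal.ofReal (t ^ n)⁻¹ ^ q *
              ∫⁻ y, (ψ y * φ y ^ (1 - q)) * (∫⁻ z in ball y (2 * t * R), G z) ^ q := by
            rw [lintegral_const_mul' _ _ (by finiteness)]
            refine mul_le_mul_right ((setLIntegral_le_lintegral _ _).trans_eq ?_) _
            refine lintegral_congr_ae ?_
            filter_upwards [hw] with y hy
            rw [hy]
        _ ≤ ENNReal.ofReal (t ^ n)⁻¹ ^ q * ((K * ENNReal.ofReal ((2 * t * R) ^ n)) ^ q *
              ∫⁻ z, (ψ z * φ z ^ (1 - q)) * G z ^ q) := by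
            gcongr
            exact lintegral_ball_average_rpow_le hq hφm hψm hG hφ0 hφt (hφ _ hr) (hψ _ hr)
        _ = _ := by
            rw [← mul_assoc, ← ENNReal.mul_rpow_of_nonneg _ _ hq0, hcon,
              ENNReal.mul_rpow_of_nonneg _ _ hq0]
            congr 1
            refine lintegral_congr_ae ?_
            filter_upwards [hw] with y hy
            rw [hy]
    calc ∫⁻ y in B, w y *
          (∫⁻ x in B ∩ univ, ∫⁻ t in Ioo (0 : ℝ) 1, G (y + t • (x - y))) ^ q
        ≤ ∫⁻ y in B, ∫⁻ t in Ioo (0 : ℝ) 1, w y * J t y ^ q := by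
          refine lintegral_mono fun y => ?_
          have hJy : Measurable fun t => J t y := hJ.comp measurable_prodMk_left
          rw [lintegral_const_mul _ (hJy.pow_const q), hswap y]
          exact mul_le_mul_right (lintegral_Ioo_rpow_le hq hJy) _
      _ = ∫⁻ t in Ioo (0 : ℝ) 1, ∫⁻ y in B, w y * J t y ^ q :=
          lintegral_lintegral_swap
            ((hwm.comp measurable_fst).mul (hJ.pow_const q)).aemeasurable
      _ ≤ ∫⁻ t in Ioo (0 : ℝ) 1,
            (K * ENNReal.ofReal (2 ^ n) / V) ^ q * volume B ^ q * ∫⁻ z, w z * G z ^ q :=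
          setLIntegral_mono' measurableSet_Ioo hslice
      _ = _ := by simp

theorem exists_segmentAveraging_of_muckenhoupt {n : ℕ} (hn : 2 ≤ n) {q θ1 θ2 : ℝ} (hq : 1 < q)
    (h1 : -((n : ℝ) - 1) < θ1) (h12 : -(n : ℝ) < θ1 + θ2)
    (h1' : θ1 < ((n : ℝ) - 1) * (q - 1)) (h12' : θ1 + θ2 < (n : ℝ) * (q - 1)) :
    ∃ K : ℝ≥0∞, K ≠ ∞ ∧ ∀ R : ℝ, 0 < R → ∃ D : En n → Set (En n),
      SegmentAveraging q (fun x => ENNReal.ofReal (weight n θ1 θ2 x)) K R D := by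
  have hq1 : 0 < q - 1 := by linarith
  have hn' : (2 : ℝ) ≤ n := by exact_mod_cast hn
  obtain ⟨a₁, a₂, ha, ha₁, ha₁', ha₂, ha₂'⟩ : ∃ a₁ a₂ : ℝ, θ1 = a₁ + a₂ * (1 - q) ∧
      -((n : ℝ) - 1) < a₁ ∧ a₁ ≤ 0 ∧ -((n : ℝ) - 1) < a₂ ∧ a₂ ≤ 0 := by
    rcases le_total θ1 0 with h | h
    · exact ⟨θ1, 0, by ring, h1, h, by linarith, le_rfl⟩
    · refine ⟨0, -(θ1 / (q - 1)), by field_simp; ring, by linarith, le_rfl, ?_, ?_⟩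
      · rw [neg_lt_neg_iff, div_lt_iff₀ hq1]; exact h1'
      · exact neg_nonpos.2 (by positivity)
  obtain ⟨s₁, s₂, hs, hs₁, hs₁', hs₂, hs₂'⟩ : ∃ s₁ s₂ : ℝ, θ1 + θ2 = s₁ + s₂ * (1 - q) ∧
      -(n : ℝ) < s₁ ∧ s₁ ≤ 0 ∧ -(n : ℝ) < s₂ ∧ s₂ ≤ 0 := by
    rcases le_total (θ1 + θ2) 0 with h | h
    · exact ⟨θ1 + θ2, 0, by ring, h12, h, by linarith, le_rfl⟩
    · refine ⟨0, -((θ1 + θ2) / (q - 1)), by field_simp; ring, by linarith, le_rfl, ?_, ?_⟩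
      · rw [neg_lt_neg_iff, div_lt_iff₀ hq1]; exact h12'
      · exact neg_nonpos.2 (by positivity)
  obtain ⟨K₁, hK₁, hψ⟩ := lintegral_weight_ball_le hn (b := s₁ - a₁) ha₁ ha₁'
    (by linarith) (by linarith)
  obtain ⟨K₂, hK₂, hφ⟩ := lintegral_weight_ball_le hn (b := s₂ - a₂) ha₂ ha₂'
    (by linarith) (by linarith)
  have hae := ae_normPrime_pos hn
  have hV0 : volume (ball (0 : En n) 1) ≠ 0 := (measure_ball_pos volume 0 one_pos).ne'
  refine ⟨((K₁ + K₂) * ENNReal.ofReal (2 ^ n) / volume (ball (0 : En n) 1)) ^ q, by finiteness,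
    fun R hR => ⟨fun _ => univ, segmentAveraging_of_factorization hq
      (φ := fun x => ENNReal.ofReal (weight n a₂ (s₂ - a₂) x))
      (ψ := fun x => ENNReal.ofReal (weight n a₁ (s₁ - a₁) x))
      (measurable_weight n _ _).ennreal_ofReal (measurable_weight n _ _).ennreal_ofReal
      (measurable_weight n _ _).ennreal_ofReal ?_ ?_ ?_ ?_ ?_ hR⟩⟩
  · filter_upwards [hae] with y hy
    have hy' : 0 < ‖y‖ := hy.trans_le (normPrime_le_norm y)
    have hp := Real.rpow_nonneg hy.le a₂
    rw [ENNReal.ofReal_rpow_of_pos (weight_pos _ _ hy),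
      ← ENNReal.ofReal_mul (weight_nonneg _ _ y)]
    congr 1
    have e : θ2 = (s₁ - a₁) + (s₂ - a₂) * (1 - q) := by linear_combination hs - ha
    rw [weight, weight, weight, Real.mul_rpow hp (by positivity), ← Real.rpow_mul hy.le,
      ← Real.rpow_mul hy'.le, ha, e, Real.rpow_add hy, Real.rpow_add hy']
    ring
  · filter_upwards [hae] with y hy
    simpa using weight_pos _ _ hy
  · exact Filter.Eventually.of_forall fun y => ENNReal.ofReal_ne_top
  · intro r hr
    filter_upwards [hae] with y hy
    refine (hφ r hr y hy).trans ?_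
    gcongr
    exact le_add_self
  · intro r hr
    filter_upwards [hae] with y hy
    refine (hψ r hr y hy).trans ?_
    gcongr
    exact le_self_add

theorem norm_le_mul_norm_segment {n : ℕ} {R t : ℝ} {x y : En n} (hy : ‖y‖ < R) (hx : R / 4 ≤ ‖x‖)
    (hxy : -(9 / 10) * (‖x‖ * ‖y‖) ≤ inner ℝ x y) (ht : t ∈ Ioo (0 : ℝ) 1) :
    ‖y‖ ≤ 20 * ‖y + t • (x - y)‖ := by
  obtain ⟨h0, h1⟩ := ht
  have hz : y + t • (x - y) = (1 - t) • y + t • x := by module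
  have e : ‖y + t • (x - y)‖ ^ 2 = ((1 - t) * ‖y‖) ^ 2 + 2 * ((1 - t) * t * inner ℝ x y)
      + (t * ‖x‖) ^ 2 := by
    rw [hz, norm_add_sq_real, norm_smul, norm_smul, real_inner_smul_left, real_inner_smul_right,
      Real.norm_of_nonneg h0.le, Real.norm_of_nonneg (sub_pos.2 h1).le, real_inner_comm]
    ring
  have hin := mul_le_mul_of_nonneg_left hxy (mul_pos (sub_pos.2 h1) h0).le
  have hy0 := norm_nonneg y
  refine abs_le_of_sq_le_sq' ?_ (by positivity) |>.2
  set a := (1 - t) * ‖y‖ with ha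
  set b := t * ‖x‖ with hb
  have hab : (1 - t) * t * (-(9 / 10) * (‖x‖ * ‖y‖)) = -(9 / 10) * (a * b) := by
    rw [ha, hb]; ring
  rw [hab] at hin
  rw [mul_pow, e]
  rcases le_total t (1 / 2) with h | h
  · have : ‖y‖ / 2 ≤ a := by rw [ha]; nlinarith
    nlinarith [sq_nonneg (b - 9 / 10 * a)]
  · have : ‖y‖ / 8 ≤ b := by rw [hb]; nlinarith
    nlinarith [sq_nonneg (a - 9 / 10 * b)]

/-- A narrow cone around the direction opposite to `y`, within a ball, lies in a smaller ball. -/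
theorem cone_subset_ball {n : ℕ} {R : ℝ} (hR : 0 < R) (y : En n) :
    {p ∈ ball (0 : En n) R | inner ℝ p y < -(9 / 10) * (‖p‖ * ‖y‖)} ⊆
      ball (-(5 / 9 * R / ‖y‖) • y) (5 / 9 * R) := by
  rintro p ⟨hp, hpy⟩
  rw [mem_ball_zero_iff] at hp
  have hy : 0 < ‖y‖ := norm_pos_iff.2 fun h => by simp [h] at hpy
  have hp0 : 0 < ‖p‖ := norm_pos_iff.2 fun h => by simp [h] at hpy
  rw [mem_ball_iff_norm]
  refine lt_of_pow_lt_pow_left₀ 2 (by positivity) ?_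
  have hc : 0 < 5 / 9 * R / ‖y‖ := by positivity
  have e : ‖p - -(5 / 9 * R / ‖y‖) • y‖ ^ 2 =
      ‖p‖ ^ 2 + 2 * (5 / 9 * R / ‖y‖ * inner ℝ p y) + (5 / 9 * R) ^ 2 := by
    rw [neg_smul, sub_neg_eq_add, norm_add_sq_real, norm_smul, real_inner_smul_right,
      Real.norm_of_nonneg hc.le, div_mul_cancel₀ _ hy.ne']
  have h := mul_lt_mul_of_pos_left hpy hc
  have e2 : 5 / 9 * R / ‖y‖ * (-(9 / 10) * (‖p‖ * ‖y‖)) = -(R * ‖p‖ / 2) := by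
    field_simp
    ring
  rw [e]
  nlinarith

theorem volume_ball_mul_le {n : ℕ} (hn : 2 ≤ n) {R c : ℝ} (hR : 0 < R) (hc : 0 < c) (hc1 : c ≤ 1)
    (y : En n) :
    volume (ball y (c * R)) ≤ ENNReal.ofReal (c ^ 2) * volume (ball (0 : En n) R) := by
  rw [volume_ball_eq y (by positivity), volume_ball_eq 0 hR, ← mul_assoc,
    ← ENNReal.ofReal_mul (by positivity), mul_pow]
  gcongr ENNReal.ofReal (?_ * _) * _
  exact pow_le_pow_of_le_one hc.le hc1 hn

theorem lintegral_segment_le {n : ℕ} {H : En n → ℝ≥0∞} (hH : Measurable H) (R : ℝ) :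
    ∫⁻ y in ball (0 : En n) R, ∫⁻ x in ball (0 : En n) R, ∫⁻ t in Ioo (0 : ℝ) 1,
      H (y + t • (x - y)) ≤
    ENNReal.ofReal (2 ^ n) * volume (ball (0 : En n) R) * ∫⁻ z, H z := by
  set B := ball (0 : En n) R
  have hcoef : ∀ s : ℝ, 1 / 2 ≤ s → ENNReal.ofReal (s ^ n)⁻¹ ≤ ENNReal.ofReal (2 ^ n) := by
    intro s hs
    refine ENNReal.ofReal_le_ofReal ?_
    rw [← inv_pow]
    have : 0 < s := by linarith
    gcongr
    rw [inv_le_comm₀ this two_pos]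
    linarith
  have hslice : ∀ t ∈ Ioo (0 : ℝ) 1, ∫⁻ y in B, ∫⁻ x in B, H (y + t • (x - y)) ≤
      ENNReal.ofReal (2 ^ n) * volume B * ∫⁻ z, H z := by
    intro t ht
    have hm : Measurable fun p : En n × En n => H (p.1 + t • (p.2 - p.1)) := by fun_prop
    have hconst : ∫⁻ _ in B, ENNReal.ofReal (2 ^ n) * ∫⁻ z, H z =
        ENNReal.ofReal (2 ^ n) * volume B * ∫⁻ z, H z := by
      rw [setLIntegral_const]
      ring
    rw [← hconst]
    rcases le_total (1 / 2) t with h | h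
    · refine lintegral_mono fun y => (setLIntegral_le_lintegral _ _).trans ?_
      rw [lintegral_comp_segment H y ht.1]
      exact mul_le_mul_left (hcoef t h) _
    · rw [lintegral_lintegral_swap hm.aemeasurable]
      refine lintegral_mono fun x => (setLIntegral_le_lintegral _ _).trans ?_
      rw [lintegral_comp_segment' H x ht.2]
      exact mul_le_mul_left (hcoef (1 - t) (by linarith)) _
  have hm : Measurable fun p : (En n × ℝ) × En n => H (p.1.1 + p.1.2 • (p.2 - p.1.1)) := by
    fun_prop
  calc ∫⁻ y in B, ∫⁻ x in B, ∫⁻ t in Ioo (0 : ℝ) 1, H (y + t • (x - y))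
      = ∫⁻ y in B, ∫⁻ t in Ioo (0 : ℝ) 1, ∫⁻ x in B, H (y + t • (x - y)) := by
        refine lintegral_congr fun y => lintegral_lintegral_swap (Measurable.aemeasurable ?_)
        have : Measurable fun p : En n × ℝ => H (y + p.2 • (p.1 - y)) := by fun_prop
        exact this
    _ = ∫⁻ t in Ioo (0 : ℝ) 1, ∫⁻ y in B, ∫⁻ x in B, H (y + t • (x - y)) :=
        lintegral_lintegral_swap hm.lintegral_prod_right'.aemeasurable
    _ ≤ ∫⁻ _ in Ioo (0 : ℝ) 1, ENNReal.ofReal (2 ^ n) * volume B * ∫⁻ z, H z :=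
        setLIntegral_mono' measurableSet_Ioo hslice
    _ = _ := by simp

theorem measurableSet_norm_ge_inter_cone {n : ℕ} (R : ℝ) (y : En n) :
    MeasurableSet {x : En n | R / 4 ≤ ‖x‖ ∧ -(9 / 10) * (‖x‖ * ‖y‖) ≤ inner ℝ x y} := by
  have h1 : Continuous fun x : En n => -(9 / 10) * (‖x‖ * ‖y‖) := by fun_prop
  have h2 : Continuous fun x : En n => inner ℝ x y := by fun_prop
  exact ((isClosed_le continuous_const continuous_norm).inter (isClosed_le h1 h2)).measurableSet

/-- For radial weights growing away from the origin, it is enough to discard a neighbourhood of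
the origin and a cone opposite to `y`: the remaining segments stay away from the origin. -/
theorem segmentAveraging_of_nonneg {n : ℕ} (hn : 2 ≤ n) {q θ : ℝ} (hq : 1 < q) (hθ : 0 ≤ θ)
    {R : ℝ} (hR : 0 < R) :
    SegmentAveraging q (fun x : En n => ENNReal.ofReal (weight n 0 θ x))
      (ENNReal.ofReal (20 ^ θ) * ENNReal.ofReal (2 ^ n)) R
      fun y => {x | R / 4 ≤ ‖x‖ ∧ -(9 / 10) * (‖x‖ * ‖y‖) ≤ inner ℝ x y} where
  measurableSet := measurableSet_norm_ge_inter_cone R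
  volume_le y hy E hE _ h := by
    set D := {x : En n | R / 4 ≤ ‖x‖ ∧ -(9 / 10) * (‖x‖ * ‖y‖) ≤ inner ℝ x y}
    set V := volume (ball (0 : En n) R)
    have hV : V ≠ ∞ := measure_ball_lt_top.ne
    have hED : volume (E ∩ D) ≠ ∞ :=
      measure_ne_top_of_subset (inter_subset_left.trans hE) hV
    have hcover : E ⊆ (E ∩ D) ∪ ball 0 (1 / 4 * R) ∪
        ball (-(5 / 9 * R / ‖y‖) • y) (5 / 9 * R) := by
      intro x hx
      by_cases h1 : ‖x‖ < 1 / 4 * R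
      · exact Or.inl (Or.inr (mem_ball_zero_iff.2 h1))
      by_cases h2 : inner ℝ x y < -(9 / 10) * (‖x‖ * ‖y‖)
      · exact Or.inr (cone_subset_ball hR y ⟨hE hx, h2⟩)
      · exact Or.inl (Or.inl ⟨hx, by linarith, not_lt.1 h2⟩)
    have hle : volume E ≤ volume (E ∩ D) + ENNReal.ofReal ((1 / 4) ^ 2) * V +
        ENNReal.ofReal ((5 / 9) ^ 2) * V := by
      refine (measure_mono hcover).trans ((measure_union_le _ _).trans ?_)
      refine add_le_add ((measure_union_le _ _).trans ?_)
        (volume_ball_mul_le hn hR (by norm_num) (by norm_num) _)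
      exact add_le_add le_rfl (volume_ball_mul_le hn hR (by norm_num) (by norm_num) _)
    have hfin := h.trans (mul_le_mul_right hle 2)
    rw [← ENNReal.toReal_le_toReal hV (by finiteness)] at hfin ⊢
    rw [ENNReal.toReal_mul, ENNReal.toReal_add (by finiteness) (by finiteness),
      ENNReal.toReal_add (by finiteness) (by finiteness), ENNReal.toReal_mul, ENNReal.toReal_mul,
      ENNReal.toReal_ofReal (by norm_num), ENNReal.toReal_ofReal (by norm_num)] at hfin
    rw [ENNReal.toReal_mul]
    have hV0 : 0 ≤ V.toReal := ENNReal.toReal_nonneg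
    norm_num at hfin ⊢
    linarith
  bound G hG := by
    set B := ball (0 : En n) R
    set w : En n → ℝ≥0∞ := fun x => ENNReal.ofReal (weight n 0 θ x) with hw
    have hwm : Measurable w := (measurable_weight n 0 θ).ennreal_ofReal
    set H : En n → ℝ≥0∞ := fun z => w z * G z ^ q
    have hH : Measurable H := hwm.mul (hG.pow_const q)
    have hpt : ∀ y ∈ B, w y * (∫⁻ x in B ∩ {x | R / 4 ≤ ‖x‖ ∧
        -(9 / 10) * (‖x‖ * ‖y‖) ≤ inner ℝ x y}, ∫⁻ t in Ioo (0 : ℝ) 1, G (y + t • (x - y))) ^ q ≤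
        volume B ^ (q - 1) * ENNReal.ofReal (20 ^ θ) *
          ∫⁻ x in B, ∫⁻ t in Ioo (0 : ℝ) 1, H (y + t • (x - y)) := by
      intro y hy
      set D := {x : En n | R / 4 ≤ ‖x‖ ∧ -(9 / 10) * (‖x‖ * ‖y‖) ≤ inner ℝ x y}
      have hD : MeasurableSet D := measurableSet_norm_ge_inter_cone R y
      have hm : Measurable fun p : En n × ℝ => G (y + p.2 • (p.1 - y)) := by fun_prop
      have hwle : ∀ x ∈ D, ∀ t ∈ Ioo (0 : ℝ) 1,
          w y ≤ ENNReal.ofReal (20 ^ θ) * w (y + t • (x - y)) := by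
        intro x hx t ht
        simp only [hw, weight, Real.rpow_zero, one_mul]
        rw [← ENNReal.ofReal_mul (by positivity), ← Real.mul_rpow (by norm_num) (norm_nonneg _)]
        exact ENNReal.ofReal_le_ofReal (Real.rpow_le_rpow (norm_nonneg _)
          (norm_le_mul_norm_segment (mem_ball_zero_iff.1 hy) hx.1 hx.2 ht) hθ)
      calc w y * (∫⁻ x in B ∩ D, ∫⁻ t in Ioo (0 : ℝ) 1, G (y + t • (x - y))) ^ q
          ≤ w y * (volume B ^ (q - 1) *
              ∫⁻ x in B ∩ D, (∫⁻ t in Ioo (0 : ℝ) 1, G (y + t • (x - y))) ^ q) := by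
            refine mul_le_mul_right ((lintegral_rpow_le_measure_rpow_mul _ hq
              hm.lintegral_prod_right'.aemeasurable).trans ?_) _
            rw [Measure.restrict_apply_univ]
            refine mul_le_mul_left (ENNReal.rpow_le_rpow (measure_mono inter_subset_left) ?_) _
            linarith
        _ = volume B ^ (q - 1) *
              ∫⁻ x in B ∩ D, w y * (∫⁻ t in Ioo (0 : ℝ) 1, G (y + t • (x - y))) ^ q := by
            rw [lintegral_const_mul' _ _ ENNReal.ofReal_ne_top, mul_left_comm]
        _ ≤ volume B ^ (q - 1) * ∫⁻ x in B ∩ D, ENNReal.ofReal (20 ^ θ) *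
              ∫⁻ t in Ioo (0 : ℝ) 1, H (y + t • (x - y)) := by
            refine mul_le_mul_right
              (setLIntegral_mono' (measurableSet_ball.inter hD) fun x hx => ?_) _
            have hmx : Measurable fun t : ℝ => G (y + t • (x - y)) := by fun_prop
            refine (mul_le_mul_right (lintegral_Ioo_rpow_le hq hmx) _).trans ?_
            rw [← lintegral_const_mul' _ _ ENNReal.ofReal_ne_top,
              ← lintegral_const_mul' _ _ ENNReal.ofReal_ne_top]
            refine setLIntegral_mono' measurableSet_Ioo fun t ht => ?_
            rw [← mul_assoc]
            exact mul_le_mul_left (hwle x hx.2 t ht) _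
        _ ≤ _ := by
            rw [lintegral_const_mul' _ _ ENNReal.ofReal_ne_top, ← mul_assoc]
            exact mul_le_mul_right (lintegral_mono_set inter_subset_left) _
    have hVq : volume B ^ (q - 1) ≠ ∞ :=
      ENNReal.rpow_ne_top_of_nonneg (by linarith) measure_ball_lt_top.ne
    refine (setLIntegral_mono' measurableSet_ball hpt).trans ?_
    rw [lintegral_const_mul' _ _ (ENNReal.mul_ne_top hVq ENNReal.ofReal_ne_top)]
    refine (mul_le_mul_right (lintegral_segment_le hH R) _).trans_eq ?_
    rw [← rpow_sub_one_mul_self hq]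
    ring

/-- weighted isoperimetric inequality of De Giorgi type, second form. -/
theorem weighted_isoperimetric_second (n : ℕ) (hn : 2 ≤ n) (q θ1 θ2 : ℝ) (hq : 1 < q)
    (hθ : (θ1, θ2) ∈ (setA n ∪ setB n) ∩ (setC n q ∪ setD n q) ∨
      (θ1 = 0 ∧ -(n : ℝ) < θ2)) :
    ∃ C : ℝ, 0 < C ∧ ∀ (R : ℝ), 0 < R → ∀ k l : ℝ, k < l → ∀ u : En n → ℝ,
      ContDiff ℝ 1 u →
      ENNReal.ofReal ((l - k) ^ q) *
          (muW n θ1 θ2 {x ∈ ball (0 : En n) R | u x ≤ k}) ^ q *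
          muW n θ1 θ2 {x ∈ ball (0 : En n) R | l ≤ u x}
      ≤ ENNReal.ofReal (C * R ^ (q * ((n : ℝ) + θ1 + θ2 + 1))) *
          ∫⁻ x in {x ∈ ball (0 : En n) R | k < u x ∧ u x < l},
            ENNReal.ofReal (‖gradient u x‖ ^ q) ∂(muW n θ1 θ2) := by
  have hn' : (2 : ℝ) ≤ n := by exact_mod_cast hn
  have hq1 : 0 < q - 1 := by linarith
  have hmuckenhoupt (h1 : -((n : ℝ) - 1) < θ1) (h12 : -(n : ℝ) < θ1 + θ2)
      (h1' : θ1 < ((n : ℝ) - 1) * (q - 1)) (h12' : θ1 + θ2 < (n : ℝ) * (q - 1)) :=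
    have ⟨_, hK, h⟩ := exists_segmentAveraging_of_muckenhoupt hn hq h1 h12 h1' h12'
    isoperimetric_of_segmentAveraging hn hq h1 h12 hK h
  rcases hθ with ⟨hAB, hCD⟩ | ⟨rfl, hθ2⟩
  · refine hmuckenhoupt ?_ ?_ ?_ ?_
    · rcases hAB with h | h <;> exact h.1
    · rcases hAB with ⟨ha, hb⟩ | ⟨-, -, h⟩
      · simp only at ha hb
        linarith
      · exact h
    · rcases hCD with h | h <;> exact h.1
    · rcases hCD with ⟨ha, hb⟩ | ⟨-, -, h⟩
      · simp only at ha hb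
        nlinarith
      · exact h
  · rcases lt_or_ge θ2 0 with h | h
    · exact hmuckenhoupt (by linarith) (by linarith) (by nlinarith) (by nlinarith)
    · exact isoperimetric_of_segmentAveraging hn hq (by linarith) (by linarith)
        (ENNReal.mul_ne_top ENNReal.ofReal_ne_top ENNReal.ofReal_ne_top)
        fun R hR => ⟨_, segmentAveraging_of_nonneg hn hq h hR⟩
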